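/- Let X be a topological space and 𝒫 the system of all bounded subsets of X (sets E such that g(E) is bounded in ℝ for every continuous g : X → ℝ). If β has no winning strategy in the G_𝒫-game on X, then X is a Namioka space. -/

import Mathlib

universe u v

section Game

variable {X : Type u} [TopologicalSpace X]

/-- In the `G_𝒫`-game, a play is recorded by `α`'s moves `m : ℕ → Set X × Set X`
(at stage `n`, `α` plays the open set `(m n).1 = Vₙ₊₁` and the set
`(m n).2 = Pₙ₊₁ ∈ 𝒫`), while `β`'s moves are given by a strategy
`σ : ℕ → (ℕ → Set X × Set X) → Set X` (so `Uₙ = σ n m`).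
`α`'s `n`-th move is legal if it is a nonempty open subset of `β`'s previous
move `σ n m` and its second component belongs to `𝒫`. -/
def AlphaLegal (P : Set (Set X)) (σ : ℕ → (ℕ → Set X × Set X) → Set X)
    (m : ℕ → Set X × Set X) (n : ℕ) : Prop :=
  IsOpen (m n).1 ∧ (m n).1.Nonempty ∧ (m n).1 ⊆ σ n m ∧ (m n).2 ∈ P

/-- `σ` is a winning strategy for `β` in the `G_𝒫`-game: it depends only on
`α`'s previous moves, its moves are legal (nonempty open, and contained in
`α`'s preceding move) as long as `α` has played legally, and in every play in
which `α` plays legally we have `(⋂ₙ Vₙ) ∩ (⋃ₙ Pₙ) = ∅`, i.e. `β` wins. -/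
def BetaWinning (P : Set (Set X)) (σ : ℕ → (ℕ → Set X × Set X) → Set X) : Prop :=
  (∀ n, ∀ m m' : ℕ → Set X × Set X, (∀ k < n, m k = m' k) → σ n m = σ n m') ∧
  (∀ m : ℕ → Set X × Set X, IsOpen (σ 0 m) ∧ (σ 0 m).Nonempty) ∧
  (∀ m : ℕ → Set X × Set X, ∀ n, (∀ k ≤ n, AlphaLegal P σ m k) →
    IsOpen (σ (n + 1) m) ∧ (σ (n + 1) m).Nonempty ∧ σ (n + 1) m ⊆ (m n).1) ∧
  (∀ m : ℕ → Set X × Set X, (∀ n, AlphaLegal P σ m n) →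
    (⋂ n, (m n).1) ∩ (⋃ n, (m n).2) = ∅)

end Game

/-- A strategy for `β` may be described by a set of states with a set-valued transition
relation: it suffices that every legal move of `α` at a good state admits a transition to
another good state. -/
theorem exists_betaWinning_of_states {X : Type u} [TopologicalSpace X] {S : Type*}
    (P : Set (Set X)) (U : S → Set X) (Good : S → Prop) (R : S → Set X × Set X → S → Prop)
    (s₀ : S) (hs₀ : Good s₀)
    (hU : ∀ s, Good s → IsOpen (U s) ∧ (U s).Nonempty)
    (hstep : ∀ s V E, Good s → IsOpen V → V.Nonempty → V ⊆ U s → E ∈ P →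
      ∃ s', Good s' ∧ U s' ⊆ V ∧ R s (V, E) s')
    (hwin : ∀ (m : ℕ → Set X × Set X) (s : ℕ → S), s 0 = s₀ → (∀ n, Good (s n)) →
      (∀ n, R (s n) (m n) (s (n + 1))) → (∀ n, (m n).1 ⊆ U (s n)) → (∀ n, (m n).2 ∈ P) →
      (⋂ n, (m n).1) ∩ (⋃ n, (m n).2) = ∅) :
    ∃ σ, BetaWinning P σ := by
  classical
  let step : S → Set X × Set X → S := fun s v =>
    if h : ∃ s', Good s' ∧ U s' ⊆ v.1 ∧ R s v s' then h.choose else s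
  have step_spec : ∀ s v, Good s → IsOpen v.1 → v.1.Nonempty → v.1 ⊆ U s → v.2 ∈ P →
      Good (step s v) ∧ U (step s v) ⊆ v.1 ∧ R s v (step s v) := by
    intro s v hs hv hne hsub hE
    have h := hstep s v.1 v.2 hs hv hne hsub hE
    simp only [step, dif_pos h]
    exact h.choose_spec
  let st : (ℕ → Set X × Set X) → ℕ → S := fun m n =>
    Nat.rec s₀ (fun k s => step s (m k)) n
  have good : ∀ m n, (∀ k < n, AlphaLegal P (fun n m => U (st m n)) m k) → Good (st m n) := by
    intro m n
    induction n with
    | zero => exact fun _ => hs₀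
    | succ n ih =>
      intro h
      obtain ⟨h₁, h₂, h₃, h₄⟩ := h n n.lt_succ_self
      exact (step_spec _ _ (ih fun k hk => h k (hk.trans n.lt_succ_self)) h₁ h₂ h₃ h₄).1
  refine ⟨fun n m => U (st m n), ?_, fun m => hU _ hs₀, ?_, ?_⟩
  · intro n m m' h
    have : st m n = st m' n := by
      induction n with
      | zero => rfl
      | succ n ih =>
        change step (st m n) (m n) = step (st m' n) (m' n)
        rw [ih fun k hk => h k (hk.trans n.lt_succ_self), h n n.lt_succ_self]
    exact congrArg U this
  · intro m n h
    have hg := hU _ (good m (n + 1) fun k hk => h k (Nat.lt_succ_iff.1 hk))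
    obtain ⟨h₁, h₂, h₃, h₄⟩ := h n le_rfl
    exact ⟨hg.1, hg.2,
      (step_spec _ _ (good m n fun k hk => h k hk.le) h₁ h₂ h₃ h₄).2.1⟩
  · intro m h
    refine hwin m (st m) rfl (fun n => good m n fun k _ => h k) (fun n => ?_)
      (fun n => (h n).2.2.1) (fun n => (h n).2.2.2)
    obtain ⟨h₁, h₂, h₃, h₄⟩ := h n
    exact (step_spec _ _ (good m n fun k _ => h k) h₁ h₂ h₃ h₄).2.2

/-- If `β` has no winning strategy in the `G_𝒫`-game, then the space is Baire. -/
theorem baireSpace_of_not_betaWinning {X : Type u} [TopologicalSpace X] {P : Set (Set X)}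
    (hβ : ¬ ∃ σ, BetaWinning P σ) : BaireSpace X := by
  refine ⟨fun G hGo hGd => ?_⟩
  by_contra hd
  rw [dense_iff_inter_open] at hd
  push Not at hd
  obtain ⟨W, hWo, hWne, hW⟩ := hd
  refine hβ (exists_betaWinning_of_states P (S := ℕ × Set X) Prod.snd
    (fun s => IsOpen s.2 ∧ s.2.Nonempty) (fun s v s' => s'.1 = s.1 + 1 ∧ s'.2 = v.1 ∩ G s.1)
    (0, W) ⟨hWo, hWne⟩ (fun _ => id) ?_ ?_)
  · intro s V E _ hV hne _ _
    exact ⟨(s.1 + 1, V ∩ G s.1), ⟨hV.inter (hGo _), (hGd s.1).inter_open_nonempty V hV hne⟩,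
      Set.inter_subset_left, rfl, rfl⟩
  · intro m s h0 _ hR hsub _
    have hidx : ∀ n, (s n).1 = n := by
      intro n
      induction n with
      | zero => rw [h0]
      | succ n ih => rw [(hR n).1, ih]
    refine Set.eq_empty_of_forall_notMem fun x hx => ?_
    have hx' := Set.mem_iInter.1 hx.1
    have : x ∈ W ∩ ⋂ n, G n := by
      refine ⟨?_, Set.mem_iInter.2 fun n => ?_⟩
      · have := hsub 0 (hx' 0)
        rwa [h0] at this
      · have := hsub (n + 1) (hx' (n + 1))
        rw [(hR n).2, hidx] at this
        exact this.2
    rw [hW] at this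
    exact this

/-- The image of a bounded set under a continuous map to a metrizable space has no
sequence converging to a point outside the range of the map. -/
theorem mem_range_of_tendsto_of_bounded {X Y : Type*} [TopologicalSpace X] [TopologicalSpace Y]
    [TopologicalSpace.MetrizableSpace Y] {E : Set X}
    (hE : ∀ g : X → ℝ, Continuous g → Bornology.IsBounded (g '' E)) {H : X → Y}
    (hH : Continuous H) {y : ℕ → X} (hy : ∀ n, y n ∈ E) {c : Y}
    (hc : Filter.Tendsto (fun n => H (y n)) Filter.atTop (nhds c)) : c ∈ Set.range H := by
  let _ := TopologicalSpace.metrizableSpaceMetric Y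
  by_contra hr
  have hpos : ∀ z, 0 < dist (H z) c := fun z => dist_pos.2 fun h => hr ⟨z, h⟩
  obtain ⟨C, hC⟩ := (hE (fun z => (dist (H z) c)⁻¹)
    ((hH.dist continuous_const).inv₀ fun z => (hpos z).ne')).exists_norm_le
  have hlim : Filter.Tendsto (fun n => (dist (H (y n)) c)⁻¹) Filter.atTop Filter.atTop :=
    Filter.Tendsto.inv_tendsto_nhdsGT_zero <| tendsto_nhdsWithin_iff.2
      ⟨tendsto_iff_dist_tendsto_zero.1 hc, Filter.Eventually.of_forall fun n => hpos _⟩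
  obtain ⟨n, hn⟩ := (hlim.eventually_gt_atTop C).exists
  exact absurd ((le_abs_self _).trans (hC _ ⟨y n, hy n, rfl⟩)) (not_le.2 hn)

/-- A bounded set is approximated, uniformly on finitely many continuous functions, by a
finite subset. -/
theorem exists_finite_approx_of_bounded {X ι : Type*} [TopologicalSpace X] {E : Set X}
    (hE : ∀ g : X → ℝ, Continuous g → Bornology.IsBounded (g '' E)) {h : ι → X → ℝ}
    (hh : ∀ i, Continuous (h i)) {I : Set ι} (hI : I.Finite) {δ : ℝ} (hδ : 0 < δ) :
    ∃ D ⊆ E, D.Finite ∧ ∀ x ∈ E, ∃ y ∈ D, ∀ i ∈ I, |h i y - h i x| < δ := by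
  have := hI.fintype
  let H : X → I → ℝ := fun x i => h i x
  have hb : Bornology.IsBounded (H '' E) := by
    rw [← Bornology.forall_isBounded_image_eval_iff]
    intro i
    rw [Set.image_image]
    exact hE _ (hh i)
  have htb : TotallyBounded (H '' E) := hb.isCompact_closure.totallyBounded.subset subset_closure
  obtain ⟨D, hDE, hDf, ht⟩ := Set.exists_subset_image_finite_and.1
    (Metric.finite_approx_of_totallyBounded htb δ hδ)
  refine ⟨D, hDE, hDf, fun x hx => ?_⟩
  obtain ⟨_, ⟨y, hy, rfl⟩, hxy⟩ := Set.mem_iUnion₂.1 (ht ⟨x, hx, rfl⟩)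
  refine ⟨y, hy, fun i hi => ?_⟩
  rw [Metric.mem_ball, dist_comm] at hxy
  exact (dist_le_pi_dist (H y) (H x) ⟨i, hi⟩).trans_lt hxy

/-- If `f` oscillates by more than `ε` on every nonempty open subset of `V`, then some `f x`
with `x ∈ V` separates two points of `K` that a given finite set of sections nearly
identifies. -/
theorem exists_pair_of_oscillation {X K : Type*} [TopologicalSpace X] [TopologicalSpace K]
    [CompactSpace K] {f : X → K → ℝ} (hfX : ∀ k, Continuous fun x => f x k)
    (hfK : ∀ x, Continuous (f x)) {V : Set X} (hV : IsOpen V) (hne : V.Nonempty) {ε : ℝ}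
    (hε : 0 < ε)
    (hosc : ∀ W ⊆ V, IsOpen W → W.Nonempty → ∃ x ∈ W, ∃ x' ∈ W, ∃ k, ε < |f x k - f x' k|)
    {D : Set X} (hD : D.Finite) {δ : ℝ} (hδ : 0 < δ) :
    ∃ q : K × K, (∀ y ∈ D, |f y q.1 - f y q.2| < δ) ∧ ∃ x ∈ V, ε / 4 < |f x q.1 - f x q.2| := by
  by_contra! hcon
  obtain ⟨T, -, hT⟩ := isCompact_univ.elim_nhds_subcover
    (fun t => {s | ∀ y ∈ D, |f y t - f y s| < δ}) (fun t _ => by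
      refine (Filter.eventually_all_finite hD).2 fun y _ => ?_
      have hc : Continuous fun s => |f y t - f y s| := (continuous_const.sub (hfK y)).abs
      exact hc.continuousAt.eventually_lt continuousAt_const (by simpa using hδ))
  obtain ⟨x₀, hx₀⟩ := hne
  let W : Set X := V ∩ ⋂ t ∈ T, {x | |f x t - f x₀ t| < ε / 8}
  have hW : IsOpen W := hV.inter <| isOpen_biInter_finset fun t _ =>
    isOpen_lt ((hfX t).sub continuous_const).abs continuous_const
  have hx₀W : x₀ ∈ W := ⟨hx₀, by
    simp only [Set.mem_iInter, Set.mem_ofPred_eq, sub_self, abs_zero]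
    exact fun _ _ => by positivity⟩
  obtain ⟨x, hx, x', hx', k, hk⟩ := hosc W Set.inter_subset_left hW ⟨x₀, hx₀W⟩
  obtain ⟨t, ht, htk⟩ := Set.mem_iUnion₂.1 (hT (Set.mem_univ k))
  have h₁ := abs_le.1 (hcon (t, k) htk x hx.1)
  have h₂ := abs_le.1 (hcon (t, k) htk x' hx'.1)
  have h₃ : |f x t - f x₀ t| < ε / 8 := (Set.mem_iInter₂.1 hx.2 t ht)
  have h₄ : |f x' t - f x₀ t| < ε / 8 := (Set.mem_iInter₂.1 hx'.2 t ht)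
  rw [abs_lt] at h₃ h₄
  refine absurd hk (not_lt.2 (abs_le.2 ⟨?_, ?_⟩)) <;> simp only at h₁ h₂ <;> linarith

/-- If a separately continuous function oscillates by more than `ε` on every nonempty open
subset of `O`, then `β` wins the game played with bounded sets. -/
theorem exists_betaWinning_of_oscillation {X : Type u} [TopologicalSpace X] {K : Type v}
    [TopologicalSpace K] [CompactSpace K] {f : X → K → ℝ} (hfX : ∀ k, Continuous fun x => f x k)
    (hfK : ∀ x, Continuous (f x)) {O : Set X} (hO : IsOpen O) (hne : O.Nonempty) {ε : ℝ}
    (hε : 0 < ε)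
    (hosc : ∀ W ⊆ O, IsOpen W → W.Nonempty → ∃ x ∈ W, ∃ x' ∈ W, ∃ k, ε < |f x k - f x' k|) :
    ∃ σ, BetaWinning
      {E : Set X | ∀ g : X → ℝ, Continuous g → Bornology.IsBounded (g '' E)} σ := by
  let h : K × K → X → ℝ := fun q x => f x q.1 - f x q.2
  have hhX : ∀ q, Continuous (h q) := fun q => (hfX q.1).sub (hfX q.2)
  have hhK : ∀ x, Continuous fun q => h q x := fun x =>
    ((hfK x).comp continuous_fst).sub ((hfK x).comp continuous_snd)
  /- A state records the stage, the open set played by `β`, a finite set of points of `X`, a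
  finite set of pairs in `K`, and the finite set of bounded sets played so far by `α`. -/
  refine exists_betaWinning_of_states _
    (S := ℕ × Set X × Set X × Set (K × K) × Set (Set X)) (fun s => s.2.1)
    (fun s => (IsOpen s.2.1 ∧ s.2.1.Nonempty) ∧ s.2.1 ⊆ O ∧ s.2.2.1.Finite ∧ s.2.2.2.1.Finite ∧
      s.2.2.2.2.Finite ∧
      ∀ E ∈ s.2.2.2.2, ∀ g : X → ℝ, Continuous g → Bornology.IsBounded (g '' E))
    (fun s v s' => s'.1 = s.1 + 1 ∧ s.2.2.1 ⊆ s'.2.2.1 ∧ s'.2.2.2.2 = insert v.2 s.2.2.2.2 ∧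
      (∀ E ∈ s'.2.2.2.2, ∀ x ∈ E, ∃ y ∈ s'.2.2.1, y ∈ E ∧
        ∀ p ∈ s.2.2.2.1, |h p y - h p x| < 1 / ((s.1 : ℝ) + 1)) ∧
      ∃ q, s'.2.2.2.1 = insert q s.2.2.2.1 ∧
        (∀ y ∈ s'.2.2.1, |h q y| < 1 / ((s.1 : ℝ) + 1)) ∧ ∀ x ∈ s'.2.1, ε / 4 < |h q x|)
    (0, O, ∅, ∅, ∅) ⟨⟨hO, hne⟩, subset_rfl, by simp⟩ (fun s hs => hs.1) ?_ ?_
  · rintro ⟨n, U, D, Q, B⟩ V E ⟨-, hUO, hD, hQ, hB, hBb⟩ hV hVne hVU hE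
    dsimp only at *
    have hδ : (0 : ℝ) < 1 / ((n : ℝ) + 1) := Nat.one_div_pos_of_nat
    have hB' : ∀ E' ∈ insert E B,
        ∀ g : X → ℝ, Continuous g → Bornology.IsBounded (g '' E') := by
      rintro E' (rfl | hE')
      exacts [hE, hBb E' hE']
    choose! A hAE hAf hA using fun E' hE' =>
      exists_finite_approx_of_bounded (hB' E' hE') hhX hQ hδ
    have hD' : (D ∪ ⋃ E' ∈ insert E B, A E').Finite := hD.union ((hB.insert E).biUnion hAf)
    obtain ⟨q, hq, x, hxV, hx⟩ := exists_pair_of_oscillation hfX hfK hV hVne hε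
      (fun W hW => hosc W (hW.trans (hVU.trans hUO))) hD' hδ
    refine ⟨(n + 1, V ∩ {x | ε / 4 < |h q x|}, D ∪ ⋃ E' ∈ insert E B, A E', insert q Q,
      insert E B), ⟨⟨hV.inter (isOpen_lt continuous_const (hhX q).abs), x, hxV, hx⟩,
      Set.inter_subset_left.trans (hVU.trans hUO), hD', hQ.insert q, hB.insert E, hB'⟩,
      Set.inter_subset_left, rfl, Set.subset_union_left, rfl, ?_, q, rfl, hq, fun x hx => hx.2⟩
    intro E' hE' x hx
    obtain ⟨y, hy, hyx⟩ := hA E' hE' x hx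
    exact ⟨y, Or.inr (Set.mem_biUnion hE' hy), hAE E' hE' hy, hyx⟩
  · intro m s h0 _ hR hsub hm
    choose hidx hDs hBs happ q hQs hqD hqx using hR
    have hidx' : ∀ n, (s n).1 = n := by
      intro n
      induction n with
      | zero => rw [h0]
      | succ n ih => rw [hidx n, ih]
    simp only [hidx'] at happ hqD
    have hDmono : Monotone fun n => (s n).2.2.1 := monotone_nat_of_le_succ hDs
    have hQmono : Monotone fun n => (s n).2.2.2.1 :=
      monotone_nat_of_le_succ fun n => (hQs n).symm ▸ Set.subset_insert _ _
    have hBmono : Monotone fun n => (s n).2.2.2.2 :=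
      monotone_nat_of_le_succ fun n => (hBs n).symm ▸ Set.subset_insert _ _
    have hqQ : ∀ {k n}, k < n → q k ∈ (s n).2.2.2.1 := fun {k n} hkn =>
      hQmono (Nat.succ_le_of_lt hkn) (by simp only [Nat.succ_eq_add_one, hQs k, Set.mem_insert])
    refine Set.eq_empty_of_forall_notMem fun x hx => ?_
    obtain ⟨i, hi⟩ := Set.mem_iUnion.1 hx.2
    have hxq : ∀ k, ε / 4 < |h (q k) x| := fun k =>
      hqx k x (hsub (k + 1) (Set.mem_iInter.1 hx.1 (k + 1)))
    have hmB : ∀ n, (m i).2 ∈ (s (i + n + 1)).2.2.2.2 := fun n =>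
      hBmono (show i + 1 ≤ i + n + 1 by omega) (by simp only [hBs i, Set.mem_insert])
    choose y hyD hyE hyx using fun n => happ (i + n) _ (hmB n) x hi
    obtain ⟨p, hp⟩ : ∃ p, MapClusterPt p Filter.atTop q :=
      exists_clusterPt_of_compactSpace _
    have hyp : ∀ n, h p (y n) = 0 := by
      intro n
      have hcl : MapClusterPt (h p (y n)) Filter.atTop fun k => h (q k) (y n) :=
        hp.continuousAt_comp (hhK (y n)).continuousAt
      have hlim : Filter.Tendsto (fun k => h (q k) (y n)) Filter.atTop (nhds 0) := by
        refine squeeze_zero_norm' ?_ (tendsto_one_div_add_atTop_nhds_zero_nat (𝕜 := ℝ))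
        filter_upwards [Filter.eventually_ge_atTop (i + n)] with k hk
        exact (hqD k (y n) (hDmono (Nat.succ_le_succ hk) (hyD n))).le
      have hne : (nhds (h p (y n)) ⊓ nhds 0).NeBot := ClusterPt.mono hcl hlim
      exact eq_of_nhds_neBot hne
    have hlim : Filter.Tendsto (fun n => ((fun k => h (q k) (y n), h p (y n)) : (ℕ → ℝ) × ℝ))
        Filter.atTop (nhds (fun k => h (q k) x, 0)) := by
      refine Filter.Tendsto.prodMk_nhds (tendsto_pi_nhds.2 fun k => ?_) (by simp [hyp])
      rw [tendsto_iff_dist_tendsto_zero]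
      refine squeeze_zero' (Filter.Eventually.of_forall fun _ => dist_nonneg) ?_
        (tendsto_one_div_add_atTop_nhds_zero_nat (𝕜 := ℝ))
      filter_upwards [Filter.eventually_gt_atTop k] with n hn
      refine (hyx n (q k) (hqQ (by omega))).le.trans ?_
      exact Nat.one_div_le_one_div (by omega)
    obtain ⟨z, hz⟩ := mem_range_of_tendsto_of_bounded (hm i)
      (H := fun x => ((fun k => h (q k) x, h p x) : (ℕ → ℝ) × ℝ))
      ((continuous_pi fun k => hhX (q k)).prodMk (hhX p)) hyE hlim
    have hz₁ : ∀ k, h (q k) z = h (q k) x := fun k => congrFun (congrArg Prod.fst hz) k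
    have hz₂ : h p z = 0 := congrArg Prod.snd hz
    have hnear : ∀ᶠ r in nhds p, |h r z| < ε / 4 :=
      (hhK z).abs.continuousAt.eventually_lt continuousAt_const (by simp [hz₂, hε])
    obtain ⟨k, hk⟩ := (hp.frequently hnear).exists
    exact absurd (hxq k) (by rw [← hz₁ k]; exact not_lt.2 hk.le)

/-- If `β` has no winning strategy in the `G_𝒫`-game on `X`, where `𝒫` is the
system of all bounded subsets of `X`, then `X` is a Namioka space: `X` is a
Baire space and for every compact `K` and separately continuous
`f : X × K → ℝ` there is a dense `G_δ` set `A ⊆ X` such that `f` is jointly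
continuous at each point of `A × K`. -/
theorem stmt13 {X : Type u} [TopologicalSpace X]
    (hβ : ¬ ∃ σ, BetaWinning
      {E : Set X | ∀ g : X → ℝ, Continuous g → Bornology.IsBounded (g '' E)} σ) :
    BaireSpace X ∧
    ∀ (K : Type v) [TopologicalSpace K] [CompactSpace K] (f : X → K → ℝ),
      (∀ k : K, Continuous fun x => f x k) → (∀ x : X, Continuous (f x)) →
      ∃ A : Set X, Dense A ∧ IsGδ A ∧
        ∀ a ∈ A, ∀ k : K, ContinuousAt (fun p : X × K => f p.1 p.2) (a, k) := by
  refine ⟨baireSpace_of_not_betaWinning hβ, fun K _ _ f hfX hfK => ?_⟩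
  have := baireSpace_of_not_betaWinning hβ
  let G : ℕ → Set X := fun n => ⋃₀ {W | IsOpen W ∧
    ∀ x ∈ W, ∀ x' ∈ W, ∀ k, |f x k - f x' k| ≤ 1 / ((n : ℝ) + 1)}
  have hGo : ∀ n, IsOpen (G n) := fun n => isOpen_sUnion fun W hW => hW.1
  have hGd : ∀ n, Dense (G n) := by
    intro n
    refine dense_iff_inter_open.2 fun O hO hne => ?_
    by_contra hemp
    refine hβ (exists_betaWinning_of_oscillation hfX hfK hO hne
      (Nat.one_div_pos_of_nat (n := n)) fun W hWO hW hWne => ?_)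
    by_contra! hcon
    obtain ⟨w, hw⟩ := hWne
    exact hemp ⟨w, hWO hw, W, ⟨hW, hcon⟩, hw⟩
  refine ⟨⋂ n, G n, dense_iInter_of_isOpen_nat hGo hGd, .iInter_of_isOpen hGo, ?_⟩
  intro a ha k
  refine Metric.tendsto_nhds.2 fun ε hε => ?_
  obtain ⟨n, hn⟩ := exists_nat_one_div_lt (half_pos hε)
  obtain ⟨W, ⟨hW, hWn⟩, haW⟩ := Set.mem_iInter.1 ha n
  have hk := Metric.tendsto_nhds.1 ((hfK a).tendsto k) (ε / 2) (half_pos hε)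
  rw [nhds_prod_eq]
  filter_upwards [Filter.prod_mem_prod (hW.mem_nhds haW) hk] with p hp
  calc dist (f p.1 p.2) (f a k) ≤ dist (f p.1 p.2) (f a p.2) + dist (f a p.2) (f a k) :=
        dist_triangle _ _ _
    _ < ε / 2 + ε / 2 := add_lt_add ((hWn p.1 hp.1 a haW p.2).trans_lt hn) hp.2
    _ = ε := add_halves ε
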